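/- Let Ω ⊂ ℝⁿ be a bounded domain with Lipschitz boundary, and suppose β > α ≥ 0, β ≥ 2, α + β < n, and 1 ≤ p ≤ 2nβ(α+β) / (2nβ − (α+β)(β−α)). Then there exists C > 0 such that for all u ∈ C²(Ω̄) with u and ∇u vanishing on ∂Ω and every i ∈ {1,…,n}, ‖D_i u‖_{L^p(Ω)} ≤ C ( [u]_{S̊₂} + 1 ), where [u]_{S̊₂} := ( ∑_{i=1}^n ∫_Ω |u|^α |D_i² u|^β dx )^{1/(α+β)}. In particular the embedding S̊_{2,α,β}(Ω) ⊂ W₀^{1,p}(Ω) holds. -/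

import Mathlib

open MeasureTheory Real Set
open Filter Topology

lemma ContinuousWithinAt.eventually_norm_le_add_one {E F : Type*} [TopologicalSpace E]
    [SeminormedAddCommGroup F] {Ω : Set E} {g : E → F} {x : E}
    (hg : ContinuousWithinAt g (closure Ω) x) : ∀ᶠ y in 𝓝[Ω] x, ‖g y‖ ≤ ‖g x‖ + 1 := by
  filter_upwards [(hg.norm.mono subset_closure).eventually_lt_const (lt_add_one ‖g x‖)]
    with y hy using hy.le

section Bounds

variable {E F : Type*} [NormedAddCommGroup E] [NormedSpace ℝ E]
  [NormedAddCommGroup F] [NormedSpace ℝ F]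

/-- A function of class `C^(k+1)` on the closure of an open set has there a `C^k` function which
coincides with its Fréchet derivative inside the set. -/
lemma ContDiffWithinAt.exists_fderiv_eq_of_closure {Ω : Set E} (hΩ : IsOpen Ω) {f : E → F} {k : ℕ}
    {x : E} (hx : x ∈ closure Ω) (hf : ContDiffWithinAt ℝ (k + 1) f (closure Ω) x) :
    ∃ f' : E → E →L[ℝ] F, ContDiffWithinAt ℝ k f' (closure Ω) x ∧
      ∀ᶠ y in 𝓝[Ω] x, fderiv ℝ f y = f' y := by
  obtain ⟨s, hs, -, -, f', hf', hc⟩ :=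
    (contDiffWithinAt_succ_iff_hasFDerivWithinAt' (by simp)).1 hf
  rw [insert_eq_of_mem hx] at hs
  refine ⟨f', hc, ?_⟩
  filter_upwards [nhdsWithin_mono x subset_closure hs, self_mem_nhdsWithin] with y hy hyΩ
  exact ((hf' y hy).hasFDerivAt
    (mem_of_superset (hΩ.mem_nhds hyΩ) subset_closure)).fderiv

/-- A `C²` function on the closure of a bounded open set is bounded together with its first and
second derivatives. -/
lemma ContDiffOn.exists_bound_derivs_of_closure [ProperSpace E] {Ω : Set E} (hΩ : IsOpen Ω)
    (hb : Bornology.IsBounded Ω) {f : E → F} (hf : ContDiffOn ℝ 2 f (closure Ω)) :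
    ∃ M : ℝ, ∀ y ∈ Ω, ‖f y‖ ≤ M ∧ ‖fderiv ℝ f y‖ ≤ M ∧ ‖fderiv ℝ (fderiv ℝ f) y‖ ≤ M := by
  have hK : IsCompact (closure Ω) := hb.isCompact_closure
  have key := hK.induction_on
    (p := fun s => ∃ M : ℝ, ∀ y ∈ s, y ∈ Ω →
      ‖f y‖ ≤ M ∧ ‖fderiv ℝ f y‖ ≤ M ∧ ‖fderiv ℝ (fderiv ℝ f) y‖ ≤ M)
    ⟨0, by simp⟩ (fun s t hst ⟨M, hM⟩ => ⟨M, fun y hy => hM y (hst hy)⟩) ?_ ?_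
  · obtain ⟨M, hM⟩ := key
    exact ⟨M, fun y hy => hM y (subset_closure hy) hy⟩
  · rintro s t ⟨M, hM⟩ ⟨N, hN⟩
    refine ⟨max M N, fun y hy hyΩ => ?_⟩
    rcases hy with hy | hy
    · obtain ⟨h1, h2, h3⟩ := hM y hy hyΩ
      exact ⟨h1.trans (le_max_left _ _), h2.trans (le_max_left _ _), h3.trans (le_max_left _ _)⟩
    · obtain ⟨h1, h2, h3⟩ := hN y hy hyΩ
      exact ⟨h1.trans (le_max_right _ _), h2.trans (le_max_right _ _), h3.trans (le_max_right _ _)⟩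
  · intro x hx
    obtain ⟨f', hc', he'⟩ := ContDiffWithinAt.exists_fderiv_eq_of_closure (k := 1) hΩ hx
      (by have := hf x hx; norm_num; exact this)
    obtain ⟨f'', hc'', he''⟩ := ContDiffWithinAt.exists_fderiv_eq_of_closure (k := 0) hΩ hx
      (by norm_num; exact_mod_cast hc')
    have hev : ∀ᶠ y in 𝓝[Ω] x, fderiv ℝ (fderiv ℝ f) y = fderiv ℝ f' y := by
      filter_upwards [eventually_eventually_nhdsWithin.2 he', self_mem_nhdsWithin] with y hy hyΩ
      rw [hΩ.nhdsWithin_eq hyΩ] at hy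
      exact Filter.EventuallyEq.fderiv_eq hy
    have hall : ∀ᶠ y in 𝓝[Ω] x, ‖f y‖ ≤ max (‖f x‖ + 1) (max (‖f' x‖ + 1) (‖f'' x‖ + 1)) ∧
        ‖fderiv ℝ f y‖ ≤ max (‖f x‖ + 1) (max (‖f' x‖ + 1) (‖f'' x‖ + 1)) ∧
        ‖fderiv ℝ (fderiv ℝ f) y‖ ≤ max (‖f x‖ + 1) (max (‖f' x‖ + 1) (‖f'' x‖ + 1)) := by
      filter_upwards [(hf x hx).continuousWithinAt.eventually_norm_le_add_one,
        hc'.continuousWithinAt.eventually_norm_le_add_one,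
        hc''.continuousWithinAt.eventually_norm_le_add_one, he', he'', hev] with y h1 h2 h3 h4 h5 h6
      rw [h6, h5, h4]
      exact ⟨le_max_of_le_left h1, le_max_of_le_right (le_max_of_le_left h2),
        le_max_of_le_right (le_max_of_le_right h3)⟩
    rw [eventually_nhdsWithin_iff] at hall
    exact ⟨_, mem_nhdsWithin_of_mem_nhds hall, _, fun y hy hyΩ => hy hyΩ⟩

end Bounds

/-- A smooth approximation of the identity of `ℝ` which vanishes near the origin. -/
lemma exists_contDiff_truncation : ∃ φ : ℝ → ℝ, ContDiff ℝ 1 φ ∧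
    (∃ K : ℝ, 0 ≤ K ∧ ∀ t, |deriv φ t| ≤ K) ∧ (∀ t, |t| ≤ 1 → φ t = 0) ∧
    (∀ t, 2 < |t| → φ t = t ∧ deriv φ t = 1) ∧ ∀ t, |φ t| ≤ |t| := by
  have hφ : ContDiff ℝ 1 (fun t : ℝ => t * smoothTransition (t ^ 2 - 1)) :=
    contDiff_id.mul (smoothTransition.contDiff.comp
      (by fun_prop : ContDiff ℝ 1 fun t : ℝ => t ^ 2 - 1))
  have hlarge : ∀ t : ℝ, 2 ≤ |t| → t * smoothTransition (t ^ 2 - 1) = t := by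
    intro t ht
    have : 4 ≤ t ^ 2 := by rw [← sq_abs]; nlinarith
    rw [smoothTransition.one_of_one_le (by linarith), mul_one]
  have hderiv : ∀ t : ℝ, 2 < |t| →
      deriv (fun t : ℝ => t * smoothTransition (t ^ 2 - 1)) t = 1 := by
    intro t ht
    have : (fun t : ℝ => t * smoothTransition (t ^ 2 - 1)) =ᶠ[𝓝 t] fun t => t := by
      filter_upwards [continuous_abs.continuousAt.eventually (lt_mem_nhds ht)] with s hs
      exact hlarge s (le_of_lt hs)
    rw [this.deriv_eq]
    simp
  refine ⟨_, hφ, ?_, ?_, fun t ht => ⟨hlarge t ht.le, hderiv t ht⟩, ?_⟩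
  · have hc := hφ.continuous_deriv le_rfl
    obtain ⟨K, hK⟩ := (isCompact_Icc (a := (-2 : ℝ)) (b := 2)).exists_bound_of_continuousOn
      hc.continuousOn
    refine ⟨max K 1, by positivity, fun t => ?_⟩
    by_cases ht : |t| ≤ 2
    · exact (hK t (abs_le.1 ht)).trans (le_max_left _ _)
    · rw [hderiv t (not_le.1 ht)]
      simp
  · intro t ht
    have : t ^ 2 ≤ 1 := by rw [← sq_abs]; nlinarith [abs_nonneg t]
    rw [smoothTransition.zero_of_nonpos (by linarith), mul_zero]
  · intro t
    rw [abs_mul, abs_of_nonneg (smoothTransition.nonneg _)]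
    exact mul_le_of_le_one_right (abs_nonneg t) (smoothTransition.le_one _)

lemma countable_setOf_eq_zero_and_deriv_ne_zero (f f' : ℝ → ℝ) (s : Set ℝ)
    (hf : ∀ t ∈ s, HasDerivAt f (f' t) t) : {t ∈ s | f t = 0 ∧ f' t ≠ 0}.Countable := by
  refine (HereditarilyLindelofSpace.isLindelof _).countable ?_
  refine isDiscrete_iff_discreteTopology.1 (IsDiscrete.of_nhdsWithin fun x hx => ?_)
  have h := eventually_nhdsWithin_iff.1 ((hf x hx.1).eventually_ne (c := 0) hx.2.2)
  rw [le_pure_iff, mem_nhdsWithin_iff_eventually]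
  filter_upwards [h] with z hz hzs
  by_contra hne
  exact hz hne hzs.2.1

/-- The partial derivatives of a function vanish almost everywhere on its zero set. -/
lemma ae_fderiv_eq_zero_of_eq_zero {n : ℕ} {Ω : Set (Fin n → ℝ)} (hΩ : IsOpen Ω)
    {u : (Fin n → ℝ) → ℝ} (hu : ContDiffOn ℝ 1 u Ω) (v : Fin n → ℝ) :
    ∀ᵐ x ∂(volume.restrict Ω), u x = 0 → fderiv ℝ u x v = 0 := by
  have hcu := hu.continuousOn
  have hcd : ContinuousOn (fun x => fderiv ℝ u x v) Ω :=
    (hu.continuousOn_fderiv_of_isOpen hΩ le_rfl).clm_apply continuousOn_const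
  have hmeas : MeasurableSet {x | x ∈ Ω ∧ (u x = 0 ∧ fderiv ℝ u x v ≠ 0)} := by
    have h1 := hcd.isOpen_inter_preimage hΩ (isOpen_ne (x := (0 : ℝ)))
    have h2 := hcu.isOpen_inter_preimage hΩ (isOpen_ne (x := (0 : ℝ)))
    convert h1.measurableSet.diff h2.measurableSet using 1
    ext x
    simp
    tauto
  rw [ae_restrict_iff' hΩ.measurableSet]
  have key := ae_mem_of_ae_add_linearMap_mem (LinearMap.toSpanSingleton ℝ (Fin n → ℝ) v)
    volume volume hmeas.compl (fun y => ?_)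
  · filter_upwards [key] with x hx hxΩ h0
    by_contra h
    exact hx ⟨hxΩ, h0, h⟩
  · have hcount := countable_setOf_eq_zero_and_deriv_ne_zero (fun t => u (y + t • v))
      (fun t => fderiv ℝ u (y + t • v) v) {t | y + t • v ∈ Ω} (fun t ht => ?_)
    · have := hcount.ae_notMem volume
      filter_upwards [this] with t ht h
      exact ht h
    · have hd : HasFDerivAt u (fderiv ℝ u (y + t • v)) (y + t • v) :=
        ((hu.differentiableOn one_ne_zero).differentiableAt (hΩ.mem_nhds ht)).hasFDerivAt
      have hl : HasDerivAt (fun t : ℝ => y + t • v) v t := by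
        simpa using ((hasDerivAt_id t).smul_const v).const_add y
      exact hd.comp_hasDerivAt t hl

lemma IsOpen.indicator_eventuallyEq_of_mem {E F : Type*} [TopologicalSpace E] [Zero F]
    {Ω : Set E} (hΩ : IsOpen Ω) (h : E → F) {x : E} (hx : x ∈ Ω) :
    Ω.indicator h =ᶠ[𝓝 x] h := by
  filter_upwards [hΩ.mem_nhds hx] with y hy using indicator_of_mem hy h

lemma IsCompact.indicator_eventuallyEq_zero {E F : Type*} [TopologicalSpace E] [T2Space E] [Zero F]
    {Ω K : Set E} (hK : IsCompact K) {h : E → F} (h0 : ∀ x ∈ Ω, x ∉ K → h x = 0)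
    {x : E} (hx : x ∉ K) : Ω.indicator h =ᶠ[𝓝 x] 0 := by
  filter_upwards [hK.isClosed.isOpen_compl.mem_nhds hx] with y hy
  by_cases hyΩ : y ∈ Ω
  · simpa [hyΩ] using h0 y hyΩ hy
  · simp [hyΩ]

lemma IsCompact.hasCompactSupport_indicator {E F : Type*} [TopologicalSpace E] [T2Space E] [Zero F]
    {Ω K : Set E} (hK : IsCompact K) {h : E → F} (h0 : ∀ x ∈ Ω, x ∉ K → h x = 0) :
    HasCompactSupport (Ω.indicator h) :=
  HasCompactSupport.intro hK fun _ hx => (hK.indicator_eventuallyEq_zero h0 hx).eq_of_nhds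

section Cutoff

variable {E F : Type*} [NormedAddCommGroup E] [NormedSpace ℝ E]
  [NormedAddCommGroup F] [NormedSpace ℝ F]

lemma ContDiffOn.contDiff_indicator {Ω K : Set E} (hΩ : IsOpen Ω) (hK : IsCompact K)
    (hKΩ : K ⊆ Ω) {h : E → F} {m : WithTop ℕ∞} (hh : ContDiffOn ℝ m h Ω)
    (h0 : ∀ x ∈ Ω, x ∉ K → h x = 0) : ContDiff ℝ m (Ω.indicator h) := by
  rw [contDiff_iff_contDiffAt]
  intro x
  by_cases hx : x ∈ K
  · exact (hh.contDiffAt (hΩ.mem_nhds (hKΩ hx))).congr_of_eventuallyEq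
      (hΩ.indicator_eventuallyEq_of_mem h (hKΩ hx))
  · exact contDiffAt_const.congr_of_eventuallyEq (hK.indicator_eventuallyEq_zero h0 hx)

lemma fderiv_indicator_eq {Ω K : Set E} (hΩ : IsOpen Ω) (hK : IsCompact K)
    (hKΩ : K ⊆ Ω) {h : E → F} (h0 : ∀ x ∈ Ω, x ∉ K → h x = 0) :
    fderiv ℝ (Ω.indicator h) = Ω.indicator (fderiv ℝ h) := by
  ext1 x
  by_cases hx : x ∈ Ω
  · rw [indicator_of_mem hx, (hΩ.indicator_eventuallyEq_of_mem h hx).fderiv_eq]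
  · rw [indicator_of_notMem hx,
      (hK.indicator_eventuallyEq_zero h0 (fun hk => hx (hKΩ hk))).fderiv_eq]
    exact fderiv_const_apply _

/-- The integral of a directional derivative of a compactly supported function vanishes. -/
lemma setIntegral_fderiv_eq_zero [FiniteDimensional ℝ E] [MeasurableSpace E] [BorelSpace E]
    (μ : Measure E) [μ.IsAddHaarMeasure] {Ω K : Set E} (hΩ : IsOpen Ω) (hK : IsCompact K)
    (hKΩ : K ⊆ Ω) {h : E → ℝ} (hh : ContDiffOn ℝ 1 h Ω) (h0 : ∀ x ∈ Ω, x ∉ K → h x = 0) (v : E) :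
    ∫ x in Ω, fderiv ℝ h x v ∂μ = 0 := by
  have hG := hh.contDiff_indicator hΩ hK hKΩ h0
  have hs := hK.hasCompactSupport_indicator h0
  have hd : Continuous fun x => fderiv ℝ (Ω.indicator h) x v :=
    (hG.continuous_fderiv one_ne_zero).clm_apply continuous_const
  have key := integral_mul_fderiv_eq_neg_fderiv_mul_of_integrable (μ := μ)
    (f := fun _ => (1 : ℝ)) (g := Ω.indicator h) (v := v) (by simp)
    (by simpa using hd.integrable_of_hasCompactSupport (hs.fderiv_apply ℝ v))
    (by simpa using hG.continuous.integrable_of_hasCompactSupport hs)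
    (fun x _ => by fun_prop) (fun x _ => hG.differentiable one_ne_zero x)
  rw [fderiv_indicator_eq hΩ hK hKΩ h0] at key
  have : ∀ x, (Ω.indicator (fderiv ℝ h) x) v = Ω.indicator (fun x => fderiv ℝ h x v) x := by
    intro x
    by_cases hx : x ∈ Ω <;> simp [hx]
  simpa [this, integral_indicator hΩ.measurableSet] using key

/-- The superlevel sets of a function vanishing on the boundary are compact. -/
lemma isCompact_and_subset_superlevel {E : Type*} [PseudoMetricSpace E] [ProperSpace E]
    {Ω : Set E} (hΩ : IsOpen Ω) (hb : Bornology.IsBounded Ω)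
    {u : E → ℝ} (hc : ContinuousOn u (closure Ω)) (h0 : ∀ x ∈ frontier Ω, u x = 0)
    {δ : ℝ} (hδ : 0 < δ) :
    IsCompact {x ∈ closure Ω | δ ≤ |u x|} ∧ {x ∈ closure Ω | δ ≤ |u x|} ⊆ Ω := by
  constructor
  · refine Metric.isCompact_of_isClosed_isBounded ?_ (hb.closure.subset (sep_subset _ _))
    exact hc.abs.preimage_isClosed_of_isClosed isClosed_closure isClosed_Ici
  · rintro x ⟨hx, hxδ⟩
    by_contra hxΩ
    have := h0 x (by rw [hΩ.frontier_eq]; exact ⟨hx, hxΩ⟩)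
    rw [this, abs_zero] at hxδ
    exact absurd hxδ (not_le.2 hδ)

end Cutoff

lemma hasDerivAt_abs_rpow_mul_self {r : ℝ} (hr : 0 < r) (s : ℝ) :
    HasDerivAt (fun s : ℝ => |s| ^ r * s) ((r + 1) * |s| ^ r) s := by
  rcases eq_or_ne s 0 with rfl | hs
  · rw [abs_zero, zero_rpow hr.ne', mul_zero, hasDerivAt_iff_tendsto_slope_zero]
    have : Tendsto (fun t : ℝ => |t| ^ r) (𝓝[≠] 0) (𝓝 0) := by
      have h : ContinuousAt (fun t : ℝ => |t| ^ r) 0 :=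
        (continuous_abs.rpow_const fun _ => Or.inr hr.le).continuousAt
      simpa [ContinuousAt, zero_rpow hr.ne'] using h.mono_left nhdsWithin_le_nhds
    refine this.congr' ?_
    filter_upwards [self_mem_nhdsWithin] with t ht
    have ht : t ≠ 0 := ht
    simp [field]
  · have h1 : HasDerivAt (fun s : ℝ => |s| ^ r) (SignType.sign s * r * |s| ^ (r - 1)) s :=
      (hasDerivAt_abs hs).rpow_const (Or.inl (abs_ne_zero.2 hs))
    refine (h1.mul (hasDerivAt_id s)).congr_deriv ?_
    have : |s| ^ r = |s| ^ (r - 1) * |s| := by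
      rw [← rpow_add_one (abs_ne_zero.2 hs)]; ring_nf
    rw [this, id, mul_one]
    have h2 : (SignType.sign s : ℝ) * s = |s| := sign_mul_self s
    linear_combination r * |s| ^ (r - 1) * h2

lemma contDiff_abs_rpow_mul_self {r : ℝ} (hr : 0 < r) :
    ContDiff ℝ 1 (fun s : ℝ => |s| ^ r * s) := by
  rw [contDiff_one_iff_deriv]
  refine ⟨fun s => (hasDerivAt_abs_rpow_mul_self hr s).differentiableAt, ?_⟩
  have : deriv (fun s : ℝ => |s| ^ r * s) = fun s => (r + 1) * |s| ^ r :=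
    funext fun s => (hasDerivAt_abs_rpow_mul_self hr s).deriv
  rw [this]
  exact continuous_const.mul (continuous_abs.rpow_const fun _ => Or.inr hr.le)

/-- A continuous bounded function on an open bounded set is integrable. -/
lemma ContinuousOn.integrableOn_of_bound {n : ℕ} {Ω : Set (Fin n → ℝ)} (hΩ : IsOpen Ω)
    (hb : Bornology.IsBounded Ω) {f : (Fin n → ℝ) → ℝ} (hf : ContinuousOn f Ω) {M : ℝ}
    (hM : ∀ x ∈ Ω, |f x| ≤ M) : IntegrableOn f Ω :=
  IntegrableOn.of_bound hb.measure_lt_top (hf.aestronglyMeasurable hΩ.measurableSet) M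
    ((ae_restrict_iff' hΩ.measurableSet).2 (Eventually.of_forall hM))

/-- Integration by parts: the `L^(r+2)` norm of a directional derivative is controlled by the
function and its second derivative in the same direction. -/
lemma integral_abs_fderiv_rpow_le {n : ℕ} {Ω : Set (Fin n → ℝ)} (hΩ : IsOpen Ω)
    (hb : Bornology.IsBounded Ω) {u : (Fin n → ℝ) → ℝ} (hu : ContDiffOn ℝ 2 u Ω)
    (hc : ContinuousOn u (closure Ω)) (h0 : ∀ x ∈ frontier Ω, u x = 0) (v : Fin n → ℝ)
    {M : ℝ} (hM : ∀ x ∈ Ω, |u x| ≤ M ∧ |fderiv ℝ u x v| ≤ M ∧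
      |fderiv ℝ (fun y => fderiv ℝ u y v) x v| ≤ M) {r : ℝ} (hr : 0 < r) :
    ∫ x in Ω, |fderiv ℝ u x v| ^ (r + 2) ≤ (r + 1) *
      ∫ x in Ω, |u x| * |fderiv ℝ u x v| ^ r * |fderiv ℝ (fun y => fderiv ℝ u y v) x v| := by
  obtain ⟨φ, hφ, ⟨L, hL0, hL⟩, hφ0, hφ1, hφle⟩ := exists_contDiff_truncation
  set w := fun x => fderiv ℝ u x v with hw
  set z := fun x => fderiv ℝ w x v with hz
  have hwC : ContDiffOn ℝ 1 w Ω :=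
    (hu.fderiv_of_isOpen hΩ (by norm_num)).clm_apply contDiffOn_const
  have hzC : ContinuousOn z Ω :=
    (hwC.continuousOn_fderiv_of_isOpen hΩ le_rfl).clm_apply continuousOn_const
  have hu1 : ContDiffOn ℝ 1 u Ω := hu.of_le (by norm_num)
  have huc : ContinuousOn u Ω := hu.continuousOn
  have hwc : ContinuousOn w Ω := hwC.continuousOn
  have hφd : Continuous (deriv φ) := hφ.continuous_deriv le_rfl
  have hwr : ∀ {s : ℝ}, 0 < s → ContinuousOn (fun x => |w x| ^ s) Ω := fun hs =>
    hwc.abs.rpow_const fun _ _ => Or.inr hs.le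
  have step : ∀ ε : ℝ, 0 < ε → ∫ x in Ω, deriv φ (u x / ε) * |w x| ^ (r + 2) ≤
      (r + 1) * ∫ x in Ω, |u x| * |w x| ^ r * |z x| := by
    intro ε hε
    obtain ⟨hK, hKΩ⟩ := isCompact_and_subset_superlevel hΩ hb hc h0 hε
    set h := fun x => ε * φ (u x / ε) * (|w x| ^ r * w x) with hh
    have hhC : ContDiffOn ℝ 1 h Ω :=
      (contDiffOn_const.mul (hφ.comp_contDiffOn (hu1.div_const ε))).mul
        ((contDiff_abs_rpow_mul_self hr).comp_contDiffOn hwC)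
    have hh0 : ∀ x ∈ Ω, x ∉ {x ∈ closure Ω | ε ≤ |u x|} → h x = 0 := by
      intro x hx hxK
      have : |u x / ε| ≤ 1 := by
        rw [abs_div, abs_of_pos hε, div_le_one hε]
        by_contra hlt
        exact hxK ⟨subset_closure hx, (not_le.1 hlt).le⟩
      simp [hh, hφ0 _ this]
    have hfd : ∀ x ∈ Ω, fderiv ℝ h x v = deriv φ (u x / ε) * |w x| ^ (r + 2) +
        ε * φ (u x / ε) * ((r + 1) * |w x| ^ r * z x) := by
      intro x hx
      have hud : HasFDerivAt u (fderiv ℝ u x) x :=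
        ((hu1.differentiableOn one_ne_zero).differentiableAt (hΩ.mem_nhds hx)).hasFDerivAt
      have hwd : HasFDerivAt w (fderiv ℝ w x) x :=
        ((hwC.differentiableOn one_ne_zero).differentiableAt (hΩ.mem_nhds hx)).hasFDerivAt
      have hφx : HasDerivAt (fun t => ε * φ (t / ε)) (deriv φ (u x / ε)) (u x) := by
        have h1 := (hφ.differentiable one_ne_zero (u x / ε)).hasDerivAt.comp (u x)
          ((hasDerivAt_id (u x)).div_const ε)
        refine (h1.const_mul ε).congr_deriv ?_
        field_simp
      have h2 := (hφx.comp_hasFDerivAt x hud).mul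
        ((hasDerivAt_abs_rpow_mul_self hr (w x)).comp_hasFDerivAt x hwd)
      have h3 : HasFDerivAt h _ x := h2
      rw [h3.fderiv]
      have h4 : |w x| ^ (r + 2) = |w x| ^ r * w x * w x := by
        rw [rpow_add' (abs_nonneg _) (by positivity), rpow_two, sq_abs]; ring
      rw [h4]
      simp only [Function.comp, add_apply, smul_apply,
        smul_eq_mul]
      change _ * (_ * z x) + _ * (_ * w x) = _
      ring
    have hz0 := setIntegral_fderiv_eq_zero volume hΩ hK hKΩ hhC hh0 v
    have hφb : ∀ x, |ε * φ (u x / ε)| ≤ |u x| := by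
      intro x
      rw [abs_mul, abs_of_pos hε]
      calc ε * |φ (u x / ε)| ≤ ε * |u x / ε| :=
          mul_le_mul_of_nonneg_left (hφle _) hε.le
        _ = |u x| := by rw [abs_div, abs_of_pos hε]; field_simp
    have hi1 : IntegrableOn (fun x => deriv φ (u x / ε) * |w x| ^ (r + 2)) Ω := by
      refine ContinuousOn.integrableOn_of_bound (M := L * M ^ (r + 2)) hΩ hb
        ((hφd.comp_continuousOn (huc.div_const ε)).mul (hwr (by positivity))) fun x hx => ?_
      rw [abs_mul, abs_of_nonneg (rpow_nonneg (abs_nonneg (w x)) (r + 2))]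
      gcongr
      exacts [hL _, (hM x hx).2.1]
    have hi2 : IntegrableOn (fun x => ε * φ (u x / ε) * ((r + 1) * |w x| ^ r * z x)) Ω := by
      refine ContinuousOn.integrableOn_of_bound (M := M * ((r + 1) * M ^ r * M)) hΩ hb
        ((continuousOn_const.mul (hφ.continuous.comp_continuousOn (huc.div_const ε))).mul
          ((continuousOn_const.mul (hwr hr)).mul hzC)) fun x hx => ?_
      have hM0 : 0 ≤ M := (abs_nonneg _).trans (hM x hx).1
      rw [abs_mul, abs_mul (_ * _) (z x), abs_mul (r + 1), abs_of_pos (by positivity : 0 < r + 1),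
        abs_of_nonneg (rpow_nonneg (abs_nonneg (w x)) r)]
      gcongr
      exacts [(hφb x).trans (hM x hx).1, (hM x hx).2.1, (hM x hx).2.2]
    have hi3 : IntegrableOn (fun x => (r + 1) * (|u x| * |w x| ^ r * |z x|)) Ω := by
      refine ContinuousOn.integrableOn_of_bound (M := (r + 1) * (M * M ^ r * M)) hΩ hb
        (continuousOn_const.mul ((huc.abs.mul (hwr hr)).mul hzC.abs)) fun x hx => ?_
      have hM0 : 0 ≤ M := (abs_nonneg _).trans (hM x hx).1
      rw [abs_of_nonneg (by positivity)]
      gcongr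
      exacts [(hM x hx).1, (hM x hx).2.1, (hM x hx).2.2]
    rw [setIntegral_congr_fun hΩ.measurableSet hfd, integral_add hi1 hi2] at hz0
    rw [eq_neg_of_add_eq_zero_left hz0, ← integral_neg, ← integral_const_mul]
    refine integral_mono hi2.neg hi3 fun x => ?_
    calc -(ε * φ (u x / ε) * ((r + 1) * |w x| ^ r * z x))
        ≤ |ε * φ (u x / ε) * ((r + 1) * |w x| ^ r * z x)| := neg_le_abs _
      _ = |ε * φ (u x / ε)| * ((r + 1) * |w x| ^ r * |z x|) := by
        rw [abs_mul, abs_mul (_ * _) (z x), abs_mul (r + 1),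
          abs_of_pos (by positivity : 0 < r + 1),
          abs_of_nonneg (rpow_nonneg (abs_nonneg (w x)) r)]
      _ ≤ |u x| * ((r + 1) * |w x| ^ r * |z x|) :=
          mul_le_mul_of_nonneg_right (hφb x) (by positivity)
      _ = (r + 1) * (|u x| * |w x| ^ r * |z x|) := by ring
  have hlim : Tendsto (fun k : ℕ => ∫ x in Ω, deriv φ (u x / (1 / ((k : ℝ) + 1))) * |w x| ^ (r + 2))
      atTop (𝓝 (∫ x in Ω, |w x| ^ (r + 2))) := by
    refine tendsto_integral_of_dominated_convergence (fun _ => L * M ^ (r + 2)) (fun k => ?_)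
      (integrableOn_const hb.measure_lt_top.ne) (fun k => ?_) ?_
    · exact ((hφd.comp_continuousOn (huc.div_const _)).mul
        (hwr (by positivity))).aestronglyMeasurable hΩ.measurableSet
    · refine (ae_restrict_iff' hΩ.measurableSet).2 (Eventually.of_forall fun x hx => ?_)
      rw [norm_eq_abs, abs_mul, abs_of_nonneg (rpow_nonneg (abs_nonneg (w x)) (r + 2))]
      gcongr
      exacts [hL _, (hM x hx).2.1]
    · filter_upwards [ae_fderiv_eq_zero_of_eq_zero hΩ hu1 v] with x hx
      by_cases hux : u x = 0
      · have hwx : w x = 0 := hx hux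
        have : (0 : ℝ) ^ (r + 2) = 0 := zero_rpow (by positivity)
        simp [hwx, this]
      · refine tendsto_const_nhds.congr' ?_
        have hev : ∀ᶠ k : ℕ in atTop, 2 / |u x| < (k : ℝ) + 1 :=
          (tendsto_natCast_atTop_atTop.atTop_add tendsto_const_nhds).eventually_gt_atTop _
        filter_upwards [hev] with k hk
        have hpos : 0 < |u x| := abs_pos.2 hux
        rw [(hφ1 _ _).2, one_mul]
        rw [div_div_eq_mul_div, div_one, abs_mul, abs_of_pos (by positivity : (0 : ℝ) < k + 1)]
        rwa [div_lt_iff₀' hpos] at hk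
  exact le_of_tendsto' hlim fun k => step _ (by positivity)

open scoped NNReal ENNReal in
/-- Sobolev inequality for functions vanishing continuously on the boundary of an open bounded set,
without any regularity of the boundary. -/
lemma exists_eLpNorm_le_eLpNorm_fderiv_of_zero_on_frontier {n : ℕ} (hn : 0 < n) {q s : ℝ≥0}
    (hq : 1 ≤ q) (hs : (s : ℝ)⁻¹ = (q : ℝ)⁻¹ - (n : ℝ)⁻¹) {Ω : Set (Fin n → ℝ)} (hΩ : IsOpen Ω)
    (hb : Bornology.IsBounded Ω) :
    ∃ C : ℝ≥0, ∀ u : (Fin n → ℝ) → ℝ, ContDiffOn ℝ 1 u Ω → ContinuousOn u (closure Ω) →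
      (∀ x ∈ frontier Ω, u x = 0) →
      eLpNorm u s (volume.restrict Ω) ≤
        C * eLpNorm (fun x => ‖fderiv ℝ u x‖) q (volume.restrict Ω) := by
  obtain ⟨φ, hφ, ⟨L, hL0, hL⟩, hφ0, hφ1, hφle⟩ := exists_contDiff_truncation
  refine ⟨SNormLESNormFDerivOfEqConst ℝ (volume : Measure (Fin n → ℝ)) q * L.toNNReal,
    fun u hu hc h0 => ?_⟩
  have step : ∀ ε : ℝ, 0 < ε → eLpNorm (fun x => ε * φ (u x / ε)) s (volume.restrict Ω) ≤
      (SNormLESNormFDerivOfEqConst ℝ (volume : Measure (Fin n → ℝ)) q * L.toNNReal : ℝ≥0) *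
        eLpNorm (fun x => ‖fderiv ℝ u x‖) q (volume.restrict Ω) := by
    intro ε hε
    obtain ⟨hK, hKΩ⟩ := isCompact_and_subset_superlevel hΩ hb hc h0 hε
    set h := fun x => ε * φ (u x / ε) with hh
    have hhC : ContDiffOn ℝ 1 h Ω := contDiffOn_const.mul (hφ.comp_contDiffOn (hu.div_const ε))
    have hh0 : ∀ x ∈ Ω, x ∉ {x ∈ closure Ω | ε ≤ |u x|} → h x = 0 := by
      intro x hx hxK
      have : |u x / ε| ≤ 1 := by
        rw [abs_div, abs_of_pos hε, div_le_one hε]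
        by_contra hlt
        exact hxK ⟨subset_closure hx, (not_le.1 hlt).le⟩
      simp [hh, hφ0 _ this]
    have hfd : ∀ x ∈ Ω, ‖fderiv ℝ h x‖ ≤ L.toNNReal * ‖fderiv ℝ u x‖ := by
      intro x hx
      have hud : HasFDerivAt u (fderiv ℝ u x) x :=
        ((hu.differentiableOn one_ne_zero).differentiableAt (hΩ.mem_nhds hx)).hasFDerivAt
      have hφx : HasDerivAt (fun t => ε * φ (t / ε)) (deriv φ (u x / ε)) (u x) := by
        have h1 := (hφ.differentiable one_ne_zero (u x / ε)).hasDerivAt.comp (u x)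
          ((hasDerivAt_id (u x)).div_const ε)
        refine (h1.const_mul ε).congr_deriv ?_
        field_simp
      have h3 : HasFDerivAt h _ x := hφx.comp_hasFDerivAt x hud
      rw [h3.fderiv, norm_smul, coe_toNNReal _ hL0]
      gcongr
      exact hL _
    have hsob := eLpNorm_le_eLpNorm_fderiv_of_eq (volume : Measure (Fin n → ℝ))
      (hhC.contDiff_indicator hΩ hK hKΩ hh0) (hK.hasCompactSupport_indicator hh0) hq
      (by simpa using hn) (p' := s) (by simpa using hs)
    rw [fderiv_indicator_eq hΩ hK hKΩ hh0,
      eLpNorm_indicator_eq_eLpNorm_restrict hΩ.measurableSet] at hsob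
    refine hsob.trans ?_
    rw [ENNReal.coe_mul, mul_assoc, ← eLpNorm_indicator_eq_eLpNorm_restrict hΩ.measurableSet]
    gcongr
    have hle : ∀ x, ‖Ω.indicator (fderiv ℝ h) x‖ ≤
        L.toNNReal * ‖Ω.indicator (fun x => ‖fderiv ℝ u x‖) x‖ := by
      intro x
      by_cases hx : x ∈ Ω
      · simpa [hx] using hfd x hx
      · simp [hx]
    simpa [ENNReal.smul_def] using eLpNorm_le_nnreal_smul_eLpNorm_of_ae_le_mul (μ := volume)
      (Eventually.of_forall hle) (q : ℝ≥0∞)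
  have hmeas : ∀ k : ℕ, AEStronglyMeasurable
      (fun x => 1 / ((k : ℝ) + 1) * φ (u x / (1 / ((k : ℝ) + 1)))) (volume.restrict Ω) := fun k =>
    (continuousOn_const.mul (hφ.continuous.comp_continuousOn
      (hu.continuousOn.div_const _))).aestronglyMeasurable hΩ.measurableSet
  refine (Lp.eLpNorm_lim_le_liminf_eLpNorm hmeas u ?_).trans ?_
  · refine Eventually.of_forall fun x => ?_
    by_cases hux : u x = 0
    · simp [hux, hφ0 0 (by simp)]
    · refine tendsto_const_nhds.congr' ?_
      have hev : ∀ᶠ k : ℕ in atTop, 2 / |u x| < (k : ℝ) + 1 :=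
        (tendsto_natCast_atTop_atTop.atTop_add tendsto_const_nhds).eventually_gt_atTop _
      filter_upwards [hev] with k hk
      have hpos : 0 < |u x| := abs_pos.2 hux
      rw [(hφ1 _ _).1]
      · field_simp
      · rw [div_div_eq_mul_div, div_one, abs_mul, abs_of_pos (by positivity : (0 : ℝ) < k + 1)]
        rwa [div_lt_iff₀' hpos] at hk
  · exact liminf_le_of_frequently_le' (Eventually.of_forall fun k =>
      step _ (by positivity)).frequently

/-- Hölder's inequality for three nonnegative functions. -/
lemma integral_rpow_mul_rpow_mul_rpow_le {X : Type*} [MeasurableSpace X] {μ : Measure X}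
    {f g h : X → ℝ} (hf : Integrable f μ) (hg : Integrable g μ) (hh : Integrable h μ)
    (hf0 : ∀ x, 0 ≤ f x) (hg0 : ∀ x, 0 ≤ g x) (hh0 : ∀ x, 0 ≤ h x) {a b c : ℝ}
    (ha : 0 ≤ a) (hb : 0 ≤ b) (hc : 0 ≤ c) (habc : a + b + c = 1) :
    ∫ x, f x ^ a * g x ^ b * h x ^ c ∂μ ≤
      (∫ x, f x ∂μ) ^ a * (∫ x, g x ∂μ) ^ b * (∫ x, h x ∂μ) ^ c := by
  have key := ENNReal.lintegral_prod_norm_pow_le (μ := μ) (Finset.univ : Finset (Fin 3))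
    (f := ![fun x => ENNReal.ofReal (f x), fun x => ENNReal.ofReal (g x),
      fun x => ENNReal.ofReal (h x)]) (p := ![a, b, c])
    (by
      intro i _
      fin_cases i
      exacts [hf.aemeasurable.ennreal_ofReal, hg.aemeasurable.ennreal_ofReal,
        hh.aemeasurable.ennreal_ofReal])
    (by simpa [Fin.sum_univ_three] using habc)
    (by
      intro i _
      fin_cases i
      exacts [ha, hb, hc])
  simp only [Fin.prod_univ_three, Matrix.cons_val_zero, Matrix.cons_val_one, Matrix.cons_val]
    at key
  rw [← ofReal_integral_eq_lintegral_ofReal hf (Eventually.of_forall hf0),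
    ← ofReal_integral_eq_lintegral_ofReal hg (Eventually.of_forall hg0),
    ← ofReal_integral_eq_lintegral_ofReal hh (Eventually.of_forall hh0),
    ENNReal.ofReal_rpow_of_nonneg (integral_nonneg hf0) ha,
    ENNReal.ofReal_rpow_of_nonneg (integral_nonneg hg0) hb,
    ENNReal.ofReal_rpow_of_nonneg (integral_nonneg hh0) hc,
    ← ENNReal.ofReal_mul (rpow_nonneg (integral_nonneg hf0) _),
    ← ENNReal.ofReal_mul (mul_nonneg (rpow_nonneg (integral_nonneg hf0) _)
      (rpow_nonneg (integral_nonneg hg0) _))] at key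
  have hnn : ∀ x, 0 ≤ f x ^ a * g x ^ b * h x ^ c := fun x =>
    mul_nonneg (mul_nonneg (rpow_nonneg (hf0 x) _) (rpow_nonneg (hg0 x) _))
      (rpow_nonneg (hh0 x) _)
  rw [integral_eq_lintegral_of_nonneg_ae (Eventually.of_forall hnn)
    (((hf.aemeasurable.pow_const a).mul (hg.aemeasurable.pow_const b)).mul
      (hh.aemeasurable.pow_const c)).aestronglyMeasurable]
  refine ENNReal.toReal_le_of_le_ofReal (mul_nonneg (mul_nonneg
    (rpow_nonneg (integral_nonneg hf0) _) (rpow_nonneg (integral_nonneg hg0) _))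
      (rpow_nonneg (integral_nonneg hh0) _)) ?_
  refine le_trans (le_of_eq (lintegral_congr fun x => ?_)) key
  rw [ENNReal.ofReal_rpow_of_nonneg (hf0 x) ha, ENNReal.ofReal_rpow_of_nonneg (hg0 x) hb,
    ENNReal.ofReal_rpow_of_nonneg (hh0 x) hc, ← ENNReal.ofReal_mul (rpow_nonneg (hf0 x) _),
    ← ENNReal.ofReal_mul (mul_nonneg (rpow_nonneg (hf0 x) _) (rpow_nonneg (hg0 x) _))]

lemma eLpNorm_le_sum_of_norm_le_sum_abs {X ι : Type*} [MeasurableSpace X] {μ : Measure X}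
    [Fintype ι] {f : ι → X → ℝ} {g : X → ℝ} {q : ENNReal}
    (hf : ∀ i, AEStronglyMeasurable (f i) μ) (hq : 1 ≤ q) (h : ∀ x, ‖g x‖ ≤ ∑ i, |f i x|) :
    eLpNorm g q μ ≤ ∑ i, eLpNorm (f i) q μ := by
  calc eLpNorm g q μ ≤ eLpNorm (∑ i, fun x => ‖f i x‖) q μ :=
        eLpNorm_mono_real fun x => by
          rw [Finset.sum_apply]
          exact h x
    _ ≤ ∑ i, eLpNorm (fun x => ‖f i x‖) q μ := eLpNorm_sum_le (fun i _ => (hf i).norm) hq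
    _ = ∑ i, eLpNorm (f i) q μ := Finset.sum_congr rfl fun i _ => eLpNorm_norm _

section FiniteMeasure

variable {X : Type*} [MeasurableSpace X] {μ : Measure X} [IsFiniteMeasure μ] {f : X → ℝ} {M : ℝ}

lemma eLpNorm_ofReal_eq_ofReal_integral (hf : AEStronglyMeasurable f μ)
    (hM : ∀ᵐ x ∂μ, ‖f x‖ ≤ M) {r : ℝ} (hr : 0 < r) :
    eLpNorm f (ENNReal.ofReal r) μ = ENNReal.ofReal ((∫ x, |f x| ^ r ∂μ) ^ (1 / r)) := by
  rw [MemLp.eLpNorm_eq_integral_rpow_norm (by simpa using hr) ENNReal.ofReal_ne_top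
    (MemLp.of_bound hf M hM), ENNReal.toReal_ofReal hr.le, one_div]
  rfl

/-- Monotonicity of `L^p` norms on a finite measure space, in terms of real integrals. -/
lemma integral_abs_rpow_le_mul_of_exponent_le (hf : AEStronglyMeasurable f μ)
    (hM : ∀ᵐ x ∂μ, ‖f x‖ ≤ M) {p q : ℝ} (hp : 0 < p) (hpq : p ≤ q) :
    (∫ x, |f x| ^ p ∂μ) ^ (1 / p) ≤
      (μ.real univ ^ (1 / p - 1 / q)) * (∫ x, |f x| ^ q ∂μ) ^ (1 / q) := by
  have hq := hp.trans_le hpq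
  have h := eLpNorm_le_eLpNorm_mul_rpow_measure_univ (ENNReal.ofReal_le_ofReal hpq) hf
  have hexp : 0 ≤ 1 / p - 1 / q := sub_nonneg.2 (one_div_le_one_div_of_le hp hpq)
  rw [eLpNorm_ofReal_eq_ofReal_integral hf hM hp, eLpNorm_ofReal_eq_ofReal_integral hf hM hq,
    ENNReal.toReal_ofReal hp.le, ENNReal.toReal_ofReal hq.le, ← ofReal_measureReal,
    ENNReal.ofReal_rpow_of_nonneg measureReal_nonneg hexp, ← ENNReal.ofReal_mul (by positivity),
    ENNReal.ofReal_le_ofReal_iff (by positivity)] at h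
  rwa [mul_comm]

end FiniteMeasure

lemma ContinuousLinearMap.norm_le_sum_abs_apply_single {n : ℕ} (L : (Fin n → ℝ) →L[ℝ] ℝ) :
    ‖L‖ ≤ ∑ j, |L (Pi.single j 1)| := by
  refine L.opNorm_le_bound (Finset.sum_nonneg fun _ _ => abs_nonneg _) fun y => ?_
  have h : L y = ∑ j, y j * L (Pi.single j 1) := by
    conv_lhs => rw [pi_eq_sum_univ' y]
    simp [map_sum]
  rw [h, Finset.sum_mul]
  refine (norm_sum_le _ _).trans (Finset.sum_le_sum fun j _ => ?_)
  rw [norm_mul, mul_comm, norm_eq_abs (L _)]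
  gcongr
  exact norm_le_pi_norm y j

/-- Sobolev inequality in terms of integrals of powers of the partial derivatives. -/
lemma exists_integral_abs_rpow_le_sum {n : ℕ} {q s r : ℝ} (hq : 1 ≤ q) (hqn : q < n)
    (hs0 : 0 < s) (hs : s⁻¹ = q⁻¹ - (n : ℝ)⁻¹) (hqr : q ≤ r) {Ω : Set (Fin n → ℝ)}
    (hΩ : IsOpen Ω) (hb : Bornology.IsBounded Ω) :
    ∃ C : ℝ, 0 ≤ C ∧ ∀ u : (Fin n → ℝ) → ℝ, ContDiffOn ℝ 1 u Ω → ContinuousOn u (closure Ω) →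
      (∀ x ∈ frontier Ω, u x = 0) → ∀ M : ℝ,
      (∀ x ∈ Ω, |u x| ≤ M ∧ ∀ j, |fderiv ℝ u x (Pi.single j 1)| ≤ M) →
      (∫ x in Ω, |u x| ^ s) ^ (1 / s) ≤
        C * ∑ j, (∫ x in Ω, |fderiv ℝ u x (Pi.single j 1)| ^ r) ^ (1 / r) := by
  have hn : 0 < n := by
    have : (0 : ℝ) < n := by linarith
    exact_mod_cast this
  have hq0 : 0 < q := by linarith
  have : IsFiniteMeasure (volume.restrict Ω) := ⟨by simpa using hb.measure_lt_top⟩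
  obtain ⟨C, hC⟩ := exists_eLpNorm_le_eLpNorm_fderiv_of_zero_on_frontier (q := q.toNNReal)
    (s := s.toNNReal) hn (by simpa using hq)
    (by rwa [coe_toNNReal _ hs0.le, coe_toNNReal _ hq0.le]) hΩ hb
  refine ⟨C * (volume.restrict Ω).real univ ^ (1 / q - 1 / r), by positivity,
    fun u hu hc h0 M hM => ?_⟩
  have hbd : ∀ {f : (Fin n → ℝ) → ℝ}, (∀ x ∈ Ω, |f x| ≤ M) →
      ∀ᵐ x ∂(volume.restrict Ω), ‖f x‖ ≤ M := fun hf =>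
    (ae_restrict_iff' hΩ.measurableSet).2 (Eventually.of_forall hf)
  have hm : ∀ j, AEStronglyMeasurable (fun x => fderiv ℝ u x (Pi.single j 1))
      (volume.restrict Ω) := fun j =>
    ((hu.continuousOn_fderiv_of_isOpen hΩ le_rfl).clm_apply
      continuousOn_const).aestronglyMeasurable hΩ.measurableSet
  have hvM := fun j => hbd fun x hx => (hM x hx).2 j
  have h1 := hC u hu hc h0
  change eLpNorm u (ENNReal.ofReal s) _ ≤ C * eLpNorm _ (ENNReal.ofReal q) _ at h1
  rw [eLpNorm_ofReal_eq_ofReal_integral (hu.continuousOn.aestronglyMeasurable hΩ.measurableSet)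
    (hbd fun x hx => (hM x hx).1) hs0] at h1
  have h2 : eLpNorm (fun x => ‖fderiv ℝ u x‖) (ENNReal.ofReal q) (volume.restrict Ω) ≤
      ∑ j, ENNReal.ofReal ((∫ x in Ω, |fderiv ℝ u x (Pi.single j 1)| ^ q) ^ (1 / q)) := by
    refine (eLpNorm_le_sum_of_norm_le_sum_abs hm (ENNReal.one_le_ofReal.2 hq)
      fun x => ?_).trans_eq (Finset.sum_congr rfl fun j _ =>
        eLpNorm_ofReal_eq_ofReal_integral (hm j) (hvM j) hq0)
    rw [norm_norm]
    exact (fderiv ℝ u x).norm_le_sum_abs_apply_single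
  have h3 := h1.trans (mul_le_mul_right h2 _)
  rw [← ENNReal.ofReal_sum_of_nonneg (fun _ _ => by positivity), ← ENNReal.ofReal_coe_nnreal,
    ← ENNReal.ofReal_mul C.coe_nonneg, ENNReal.ofReal_le_ofReal_iff (by positivity)] at h3
  refine h3.trans ?_
  rw [mul_assoc, Finset.mul_sum _ _ (_ ^ _)]
  gcongr with j
  exact integral_abs_rpow_le_mul_of_exponent_le (hm j) (hvM j) hq0 hqr

/-- Absorption of a sublinear power of a sum into its quadratic terms. -/
lemma sum_le_of_forall_rpow_le {ι : Type*} [Fintype ι] {y : ι → ℝ} (hy : ∀ i, 0 ≤ y i)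
    {B θ γ : ℝ} (hB : 0 ≤ B) (hθ : θ < 2)
    (h : ∀ i, y i ^ γ ≤ B * (∑ j, y j) ^ θ * y i ^ (γ - 2)) :
    ∑ j, y j ≤ ((Fintype.card ι : ℝ) ^ 2 * B) ^ (1 / (2 - θ)) := by
  have hY : 0 ≤ ∑ j, y j := Finset.sum_nonneg fun j _ => hy j
  rcases hY.eq_or_lt with hY0 | hYpos
  · rw [← hY0]
    positivity
  have hsq : ∀ i, y i ^ 2 ≤ B * (∑ j, y j) ^ θ := by
    intro i
    rcases (hy i).eq_or_lt with h0 | hpos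
    · rw [← h0, zero_pow two_ne_zero]
      positivity
    · have hp : 0 < y i ^ (γ - 2) := rpow_pos_of_pos hpos _
      refine le_of_mul_le_mul_right ?_ hp
      rw [← rpow_two, ← rpow_add hpos, add_sub_cancel]
      exact h i
  have hsum : (∑ j, y j) ^ 2 ≤ (Fintype.card ι : ℝ) ^ 2 * B * (∑ j, y j) ^ θ := by
    calc (∑ j, y j) ^ 2 ≤ (Fintype.card ι : ℝ) * ∑ j, y j ^ 2 := sq_sum_le_card_mul_sum_sq
      _ ≤ (Fintype.card ι : ℝ) * ∑ _j : ι, B * (∑ j, y j) ^ θ := by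
        gcongr with j
        exact hsq j
      _ = _ := by
        rw [Finset.sum_const, Finset.card_univ, nsmul_eq_mul]
        ring
  have hpow : (∑ j, y j) ^ (2 - θ) ≤ (Fintype.card ι : ℝ) ^ 2 * B := by
    rw [rpow_sub hYpos, rpow_two]
    exact (div_le_iff₀ (rpow_pos_of_pos hYpos _)).2 hsum
  rw [one_div]
  exact (le_rpow_inv_iff_of_pos hY (by positivity) (by linarith)).2 hpow

/-- Hölder estimate of the right-hand side of the integration by parts inequality. -/
lemma integral_abs_mul_rpow_mul_abs_le {X : Type*} [MeasurableSpace X] {μ : Measure X}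
    {u v z : X → ℝ} {α β γ s : ℝ} (hα : 0 ≤ α) (hαβ : α ≤ β) (hβ : 0 < β) (hs : 0 < s)
    (hγ : 2 ≤ γ) (hsum : 1 / β + (β - α) / (β * s) + (γ - 2) / γ = 1)
    (hf : Integrable (fun x => |u x| ^ α * |z x| ^ β) μ)
    (hg : Integrable (fun x => |u x| ^ s) μ) (hh : Integrable (fun x => |v x| ^ γ) μ) :
    ∫ x, |u x| * |v x| ^ (γ - 2) * |z x| ∂μ ≤
      (∫ x, |u x| ^ α * |z x| ^ β ∂μ) ^ (1 / β) *
        ((∫ x, |u x| ^ s ∂μ) ^ (1 / s)) ^ ((β - α) / β) *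
        ((∫ x, |v x| ^ γ ∂μ) ^ (1 / γ)) ^ (γ - 2) := by
  have hγ0 : 0 < γ := by linarith
  have hβα : 0 ≤ β - α := sub_nonneg.2 hαβ
  have key := integral_rpow_mul_rpow_mul_rpow_le hf hg hh (fun x => by positivity)
    (fun x => by positivity) (fun x => by positivity) (by positivity) (by positivity)
    (div_nonneg (by linarith) hγ0.le) hsum
  rw [← rpow_mul (integral_nonneg fun x => by positivity),
    ← rpow_mul (integral_nonneg fun x => by positivity)]
  have e1 : 1 / s * ((β - α) / β) = (β - α) / (β * s) := by field_simp
  have e2 : 1 / γ * (γ - 2) = (γ - 2) / γ := by field_simp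
  rw [e1, e2]
  refine le_trans (le_of_eq (integral_congr_ae (Eventually.of_forall fun x => ?_))) key
  have f1 : (|u x| ^ α * |z x| ^ β) ^ (1 / β) = |u x| ^ (α / β) * |z x| := by
    rw [mul_rpow (by positivity) (by positivity), ← rpow_mul (abs_nonneg _),
      ← rpow_mul (abs_nonneg _), mul_one_div, mul_one_div, div_self hβ.ne', rpow_one]
  have f2 : (|u x| ^ s) ^ ((β - α) / (β * s)) = |u x| ^ ((β - α) / β) := by
    rw [← rpow_mul (abs_nonneg _)]
    congr 1
    field_simp
  have f3 : (|v x| ^ γ) ^ ((γ - 2) / γ) = |v x| ^ (γ - 2) := by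
    rw [← rpow_mul (abs_nonneg _), mul_div_cancel₀ _ hγ0.ne']
  have f4 : |u x| = |u x| ^ (α / β) * |u x| ^ ((β - α) / β) := by
    rw [← rpow_add_of_nonneg (abs_nonneg _) (by positivity) (by positivity)]
    have : α / β + (β - α) / β = 1 := by field_simp; ring
    rw [this, rpow_one]
  beta_reduce
  rw [f1, f2, f3]
  nth_rewrite 1 [f4]
  ring

/-- Theorem 3.2, case (iii): Let `Ω ⊂ ℝⁿ` be a bounded domain
with (Lipschitz) boundary, `β > α ≥ 0`, `β ≥ 2`, `α + β < n`, and
`1 ≤ p ≤ 2nβ(α+β)/(2nβ - (α+β)(β-α))`.  There is `C > 0` such that for all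
`u ∈ C²(Ω̄)` with `u` and `∇u` vanishing on `∂Ω` and every `i`,
`‖D_i u‖_{L^p(Ω)} ≤ C([u]_{S̊₂} + 1)`, where
`[u]_{S̊₂} = (∑ i ∫_Ω |u|^α |D_i² u|^β)^{1/(α+β)}`.  In particular
`S̊_{2,α,β}(Ω) ⊂ W₀^{1,p}(Ω)`. -/
theorem stmt_10 (n : ℕ) (hn : 2 ≤ n) (Ω : Set (Fin n → ℝ))
    (hΩ_open : IsOpen Ω) (hΩ_bdd : Bornology.IsBounded Ω) (hΩ_conn : IsConnected Ω)
    (α β p : ℝ) (hα : 0 ≤ α) (hαβ : α < β) (hβ : 2 ≤ β) (hαβn : α + β < (n : ℝ))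
    (hp₁ : 1 ≤ p)
    (hp₂ : p ≤ 2 * n * β * (α + β) / (2 * n * β - (α + β) * (β - α))) :
    ∃ C : ℝ, 0 < C ∧
      ∀ u : (Fin n → ℝ) → ℝ, ContDiffOn ℝ 2 u (closure Ω) →
        (∀ x ∈ frontier Ω, u x = 0) → (∀ x ∈ frontier Ω, fderiv ℝ u x = 0) →
        ∀ i : Fin n,
        (∫ x in Ω, |fderiv ℝ u x (Pi.single i 1)| ^ p) ^ (1 / p) ≤
          C * ((∑ j : Fin n, ∫ x in Ω, |u x| ^ α *
            |fderiv ℝ (fun y => fderiv ℝ u y (Pi.single j 1)) x (Pi.single j 1)| ^ β)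
            ^ (1 / (α + β)) + 1) := by
  have : IsFiniteMeasure (volume.restrict Ω) := ⟨by simpa using hΩ_bdd.measure_lt_top⟩
  have hβ0 : 0 < β := by linarith
  have hn0 : (0 : ℝ) < n := by linarith
  have hq0 : 0 < α + β := by linarith
  have hd : 0 < β - α := by linarith
  have hD : 0 < 2 * n * β - (α + β) * (β - α) := by nlinarith [mul_pos hn0 hβ0]
  set γ : ℝ := 2 * n * β * (α + β) / (2 * n * β - (α + β) * (β - α)) with hγdef
  have hγq : α + β < γ := by
    rw [hγdef, lt_div_iff₀ hD]
    nlinarith [mul_pos hq0 (mul_pos hq0 hd)]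
  have hγ2 : 2 < γ := by linarith
  have hγ0 : 0 < γ := by linarith
  set s : ℝ := n * (α + β) / (n - (α + β)) with hsdef
  have hnq : 0 < (n : ℝ) - (α + β) := by linarith
  have hs0 : 0 < s := by positivity
  have hs : s⁻¹ = (α + β)⁻¹ - (n : ℝ)⁻¹ := by
    rw [hsdef]
    field_simp
  have hsum : 1 / β + (β - α) / (β * s) + (γ - 2) / γ = 1 := by
    have h1 : (β - α) / (β * s) = (β - α) / β * s⁻¹ := by field_simp
    have h2 : (γ - 2) / γ = 1 - 2 * γ⁻¹ := by field_simp
    have h3 : γ⁻¹ = (2 * n * β - (α + β) * (β - α)) / (2 * n * β * (α + β)) := by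
      rw [hγdef, inv_div]
    rw [h1, h2, h3, hs]
    field_simp
    ring
  obtain ⟨S, hS0, hS⟩ := exists_integral_abs_rpow_le_sum (by linarith : 1 ≤ α + β) hαβn hs0 hs
    hγq.le hΩ_open hΩ_bdd
  set θ : ℝ := (β - α) / β with hθdef
  have hθ0 : 0 ≤ θ := by positivity
  have hθ2 : 2 - θ = (α + β) / β := by
    rw [hθdef]
    field_simp
    ring
  have hθlt : θ < 2 := by
    have : 0 < 2 - θ := by rw [hθ2]; positivity
    linarith
  set V := (volume.restrict Ω).real univ ^ (1 / p - 1 / γ) with hV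
  set K := ((n : ℝ) ^ 2 * ((γ - 1) * S ^ θ)) ^ (1 / (2 - θ)) with hK
  have hγ1 : 0 ≤ γ - 1 := by linarith
  have hV0 : 0 ≤ V := by positivity
  have hK0 : 0 ≤ K := by positivity
  refine ⟨V * K + 1, by positivity, fun u hu h0 _ i => ?_⟩
  obtain ⟨M₀, hM₀⟩ := hu.exists_bound_derivs_of_closure hΩ_open hΩ_bdd
  have huΩ : ContDiffOn ℝ 2 u Ω := hu.mono subset_closure
  have hfdC : ContDiffOn ℝ 1 (fderiv ℝ u) Ω := huΩ.fderiv_of_isOpen hΩ_open (by norm_num)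
  have hsingle : ∀ j : Fin n, ‖(Pi.single j 1 : Fin n → ℝ)‖ = 1 := fun j => by
    rw [Pi.norm_single, norm_one]
  have hM : ∀ x ∈ Ω, |u x| ≤ M₀ ∧ ∀ j : Fin n, |fderiv ℝ u x (Pi.single j 1)| ≤ M₀ ∧
      |fderiv ℝ (fun y => fderiv ℝ u y (Pi.single j 1)) x (Pi.single j 1)| ≤ M₀ := by
    intro x hx
    obtain ⟨h1, h2, h3⟩ := hM₀ x hx
    refine ⟨h1, fun j => ⟨?_, ?_⟩⟩
    · simpa [hsingle] using ((fderiv ℝ u x).le_opNorm (Pi.single j 1)).trans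
        (mul_le_mul_of_nonneg_right h2 (norm_nonneg _))
    · have hdx : DifferentiableAt ℝ (fderiv ℝ u) x :=
        (hfdC.differentiableOn one_ne_zero).differentiableAt (hΩ_open.mem_nhds hx)
      have he : fderiv ℝ (fun y => fderiv ℝ u y (Pi.single j 1)) x (Pi.single j 1) =
          fderiv ℝ (fderiv ℝ u) x (Pi.single j 1) (Pi.single j 1) := by
        rw [(hdx.hasFDerivAt.clm_apply (hasFDerivAt_const _ _)).fderiv]
        simp
      rw [he, ← norm_eq_abs]
      refine ((fderiv ℝ (fderiv ℝ u) x).le_opNorm₂ _ _).trans ?_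
      simpa [hsingle] using h3
  have hvC : ∀ j : Fin n, ContDiffOn ℝ 1 (fun x => fderiv ℝ u x (Pi.single j 1)) Ω := fun j =>
    hfdC.clm_apply contDiffOn_const
  have hzC : ∀ j : Fin n, ContinuousOn
      (fun x => fderiv ℝ (fun y => fderiv ℝ u y (Pi.single j 1)) x (Pi.single j 1)) Ω := fun j =>
    ((hvC j).continuousOn_fderiv_of_isOpen hΩ_open le_rfl).clm_apply continuousOn_const
  set A : Fin n → ℝ := fun j => ∫ x in Ω, |u x| ^ α *
    |fderiv ℝ (fun y => fderiv ℝ u y (Pi.single j 1)) x (Pi.single j 1)| ^ β with hA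
  have hA0 : ∀ j, 0 ≤ A j := fun j => integral_nonneg fun x => by positivity
  have hAsum : 0 ≤ ∑ j, A j := Finset.sum_nonneg fun j _ => hA0 j
  set y : Fin n → ℝ := fun j => (∫ x in Ω, |fderiv ℝ u x (Pi.single j 1)| ^ γ) ^ (1 / γ) with hy
  have hy0 : ∀ j, 0 ≤ y j := fun j =>
    rpow_nonneg (integral_nonneg fun x => by positivity) _
  have hY0 : 0 ≤ ∑ j, y j := Finset.sum_nonneg fun j _ => hy0 j
  have hSob := hS u (huΩ.of_le (by norm_num)) hu.continuousOn h0 M₀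
    fun x hx => ⟨(hM x hx).1, fun j => ((hM x hx).2 j).1⟩
  have hpow : ∀ j, y j ^ γ ≤
      (γ - 1) * S ^ θ * (∑ j, A j) ^ (1 / β) * (∑ j, y j) ^ θ * y j ^ (γ - 2) := by
    intro j
    have h1 := integral_abs_fderiv_rpow_le hΩ_open hΩ_bdd huΩ hu.continuousOn h0 (Pi.single j 1)
      (fun x hx => ⟨(hM x hx).1, (hM x hx).2 j⟩) (r := γ - 2) (by linarith)
    have h2 := integral_abs_mul_rpow_mul_abs_le (μ := volume.restrict Ω) (u := u)
      (v := fun x => fderiv ℝ u x (Pi.single j 1))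
      (z := fun x => fderiv ℝ (fun y => fderiv ℝ u y (Pi.single j 1)) x (Pi.single j 1))
      hα hαβ.le hβ0 hs0 hγ2.le hsum
      (ContinuousOn.integrableOn_of_bound (M := M₀ ^ α * M₀ ^ β) hΩ_open hΩ_bdd
        ((huΩ.continuousOn.abs.rpow_const fun _ _ => Or.inr hα).mul
          ((hzC j).abs.rpow_const fun _ _ => Or.inr hβ0.le)) fun x hx => by
        have hM0 : 0 ≤ M₀ := (abs_nonneg _).trans (hM x hx).1
        rw [abs_of_nonneg (by positivity)]
        gcongr
        exacts [(hM x hx).1, ((hM x hx).2 j).2])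
      (ContinuousOn.integrableOn_of_bound (M := M₀ ^ s) hΩ_open hΩ_bdd
        (huΩ.continuousOn.abs.rpow_const fun _ _ => Or.inr hs0.le) fun x hx => by
        rw [abs_of_nonneg (by positivity)]
        gcongr
        exact (hM x hx).1)
      (ContinuousOn.integrableOn_of_bound (M := M₀ ^ γ) hΩ_open hΩ_bdd
        ((hvC j).continuousOn.abs.rpow_const fun _ _ => Or.inr hγ0.le) fun x hx => by
        rw [abs_of_nonneg (by positivity)]
        gcongr
        exact ((hM x hx).2 j).1)
    have hyγ : y j ^ γ = ∫ x in Ω, |fderiv ℝ u x (Pi.single j 1)| ^ γ := by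
      rw [hy]
      beta_reduce
      rw [← rpow_mul (integral_nonneg fun x => by positivity), one_div_mul_cancel hγ0.ne',
        rpow_one]
    rw [sub_add_cancel, ← hyγ] at h1
    have hAj : A j ≤ ∑ j, A j := Finset.single_le_sum (fun k _ => hA0 k) (Finset.mem_univ j)
    calc y j ^ γ ≤ (γ - 1) * ((∑ j, A j) ^ (1 / β) * (S * ∑ j, y j) ^ θ * y j ^ (γ - 2)) := by
          refine h1.trans ?_
          rw [show γ - 2 + 1 = γ - 1 by ring]
          refine mul_le_mul_of_nonneg_left (h2.trans ?_) hγ1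
          refine mul_le_mul_of_nonneg_right ?_ (rpow_nonneg (hy0 j) _)
          have hU0 : 0 ≤ (∫ x in Ω, |u x| ^ s) ^ (1 / s) :=
            rpow_nonneg (integral_nonneg fun x => by positivity) _
          exact mul_le_mul (rpow_le_rpow (hA0 j) hAj (by positivity))
            (rpow_le_rpow hU0 hSob hθ0) (rpow_nonneg hU0 _) (by positivity)
      _ = _ := by
          rw [mul_rpow hS0 hY0]
          ring
  have hYle := sum_le_of_forall_rpow_le hy0 (by positivity) hθlt hpow
  have hKA : ((Fintype.card (Fin n) : ℝ) ^ 2 * ((γ - 1) * S ^ θ * (∑ j, A j) ^ (1 / β))) ^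
      (1 / (2 - θ)) = K * (∑ j, A j) ^ (1 / (α + β)) := by
    rw [Fintype.card_fin, ← mul_assoc, mul_rpow (by positivity) (by positivity),
      ← rpow_mul hAsum, hK]
    congr 2
    rw [hθ2]
    field_simp
  rw [hKA] at hYle
  have hAp : 0 ≤ (∑ j, A j) ^ (1 / (α + β)) := rpow_nonneg hAsum _
  have hyi : y i ≤ ∑ j, y j := Finset.single_le_sum (fun k _ => hy0 k) (Finset.mem_univ i)
  calc (∫ x in Ω, |fderiv ℝ u x (Pi.single i 1)| ^ p) ^ (1 / p) ≤ V * y i :=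
        integral_abs_rpow_le_mul_of_exponent_le (M := M₀)
          ((hvC i).continuousOn.aestronglyMeasurable hΩ_open.measurableSet)
          ((ae_restrict_iff' hΩ_open.measurableSet).2
            (Eventually.of_forall fun x hx => ((hM x hx).2 i).1)) (by linarith) hp₂
    _ ≤ V * (K * (∑ j, A j) ^ (1 / (α + β))) := by
        gcongr
        exact hyi.trans hYle
    _ ≤ (V * K + 1) * ((∑ j, A j) ^ (1 / (α + β)) + 1) := by
        nlinarith [mul_nonneg hV0 hK0]
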